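/- A Kripke frame ⟨K,R⟩ satisfies axiom (A₁), i.e., for every Kripke model on ⟨K,R⟩ every formula of the form (φ→ψ)→[(ψ→θ)→(φ→θ)] holds at every node, if and only if for every k ∈ K the restriction of R to R⁺[k] is transitive (for all x,y,z ∈ R⁺[k], xRy and yRz imply xRz). -/

import Mathlib

/-- Formulas of propositional fuzzy logic: falsity, atoms (indexed by ℕ),
conjunction `&` and implication `→`. -/
inductive FuzzyFormula : Type where
  | bot  : FuzzyFormula
  | atom : ℕ → FuzzyFormula
  | conj : FuzzyFormula → FuzzyFormula → FuzzyFormula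
  | impl : FuzzyFormula → FuzzyFormula → FuzzyFormula

/-- Kripke satisfaction for a model `⟨K, R, V⟩`:
`V` is the satisfaction relation on atoms, extended to all formulas. -/
def Sat {K : Type*} (R : K → K → Prop) (V : K → ℕ → Prop) : K → FuzzyFormula → Prop
  | _, .bot => False
  | k, .atom p => V k p
  | k, .conj φ ψ => Sat R V k φ ∧ Sat R V k ψ
  | k, .impl φ ψ => ∀ k', R k k' → Sat R V k' φ → Sat R V k' ψ

/-- `x ∈ R⁺[k]`: `x` is reachable from `k` in `n ≥ 1` `R`-steps. -/
def RPlus {K : Type*} (R : K → K → Prop) (k x : K) : Prop :=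
  Relation.TransGen R k x

/-- `x ∈ R⁺⁺[k]`: `x` is reachable from `k` in `n ≥ 2` `R`-steps. -/
def RPlusPlus {K : Type*} (R : K → K → Prop) (k x : K) : Prop :=
  ∃ y, R k y ∧ Relation.TransGen R y x

/-- `x ∈ R²[k]`: `x` is reachable from `k` in exactly two `R`-steps. -/
def RSq {K : Type*} (R : K → K → Prop) (k x : K) : Prop :=
  ∃ y, R k y ∧ R y x

/-- A Kripke frame satisfies axiom (A₁),
`(φ→ψ) → [(ψ→θ) → (φ→θ)]`, in every model on the frame, if and only if for
every `k` the restriction of `R` to `R⁺[k]` is transitive. -/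
theorem stmt7 {K : Type*} (R : K → K → Prop) :
    (∀ V : K → ℕ → Prop, ∀ k : K, ∀ φ ψ θ : FuzzyFormula,
      Sat R V k (.impl (.impl φ ψ) (.impl (.impl ψ θ) (.impl φ θ))))
    ↔ (∀ k, ∀ x y z, RPlus R k x → RPlus R k y → RPlus R k z →
        R x y → R y z → R x z) := by
  constructor
  · intro h k x y z hx _ _ hxy hyz
    obtain ⟨w, hwx⟩ : ∃ w, R w x := by
      cases hx with
      | single hkx => exact ⟨_, hkx⟩
      | tail _ hwx => exact ⟨_, hwx⟩
    by_contra hxz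
    refine h (fun u _ => u = z) w (.atom 0) .bot .bot x hwx ?_ y hxy ?_ z hyz ?_
    · intro u hxu hu
      have huz : u = z := by simpa only [Sat] using hu
      exact (hxz (huz ▸ hxu)).elim
    · exact fun _ _ hu => hu
    · simp only [Sat]
  · intro h V k φ ψ θ a hka hφψ b hab hψθ c hbc hφ
    have ha : RPlus R k a := .single hka
    have hb : RPlus R k b := .tail ha hab
    have hc : RPlus R k c := .tail hb hbc
    exact hψθ c hbc (hφψ c (h k a b c ha hb hc hab hbc) hφ)
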